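/- Let M be a Peano continuum, let G be a group acting on M by homeomorphisms, and let {a,b} be a cut pair in M such that every G-translate {ga,gb} is translate inseparable and distinct translates of {a,b} are disjoint. Let Q be the quotient space of M obtained by identifying ga with gb for every g ∈ G, with quotient map q : M → Q. Then for every g ∈ G the point q(ga) = q(gb) is a global cut point of Q; moreover, distinct components of M ∖ {ga,gb} have disjoint images under q, each of which is a union of components of Q ∖ {q(ga)}. -/

import Mathlib

open Set Pointwise

/-- A generalized Peano continuum: a connected, locally compact, locally connected,
σ-compact, metrizable topological space. -/
structure IsGenPeanoContinuum (X : Type*) [TopologicalSpace X] : Prop where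
  connectedSpace : ConnectedSpace X
  locallyCompactSpace : LocallyCompactSpace X
  locallyConnectedSpace : LocallyConnectedSpace X
  sigmaCompactSpace : SigmaCompactSpace X
  metrizableSpace : TopologicalSpace.MetrizableSpace X

/-- An exhaustion of a space by compact sets. -/
structure IsExhaustion {X : Type*} [TopologicalSpace X] (C : ℕ → Set X) : Prop where
  isCompact : ∀ i, IsCompact (C i)
  subset_interior : ∀ i, C i ⊆ interior (C (i + 1))
  iUnion_eq : (⋃ i, C i) = Set.univ

/-- The space of ends of `X` with respect to the exhaustion `C`: the inverse limit of the
sets of connected components of the complements `X ∖ C i`, the bonding maps being induced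
by inclusion. -/
def EndsSpace {X : Type*} [TopologicalSpace X] (C : ℕ → Set X) : Type _ :=
  { E : ℕ → Set X //
      (∀ i, ∃ x ∈ (C i)ᶜ, E i = connectedComponentIn (C i)ᶜ x) ∧
        ∀ i, E (i + 1) ⊆ E i }

/-- `EndsSpace C` is topologized as a subspace of the product of the discrete spaces of
components. -/
instance EndsSpace.instTopologicalSpace {X : Type*} [TopologicalSpace X] (C : ℕ → Set X) :
    TopologicalSpace (EndsSpace C) :=
  TopologicalSpace.induced (fun E => (E.1 : ℕ → Set X))
    (@Pi.topologicalSpace ℕ (fun _ => Set X) fun _ => ⊥)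

/-- `G` acts on `X` by homeomorphisms. -/
def ContinuousActionOn (G X : Type*) [Group G] [TopologicalSpace X] [MulAction G X] : Prop :=
  ∀ g : G, Continuous fun x : X => g • x

/-- The action of `G` on `X` is proper: for every compact `K`, only finitely many translates
of `K` meet `K`. -/
def ProperActionOn (G X : Type*) [Group G] [TopologicalSpace X] [MulAction G X] : Prop :=
  ∀ K : Set X, IsCompact K → {g : G | ((g • K) ∩ K).Nonempty}.Finite

/-- The action of `G` on `X` is cocompact: the translates of some compact set cover `X`. -/
def CocompactActionOn (G X : Type*) [Group G] [TopologicalSpace X] [MulAction G X] : Prop :=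
  ∃ K : Set X, IsCompact K ∧ (⋃ g : G, g • K) = Set.univ

universe u

/-- `x` is a global cut point: `M ∖ {x}` is disconnected. -/
def IsGlobalCutPoint (M : Type*) [TopologicalSpace M] (x : M) : Prop :=
  ¬ IsPreconnected ({x}ᶜ : Set M)

/-- The valence of `x` equals the cardinal `n`: `M ∖ {x}` has exactly `n` ends (with respect
to any exhaustion). -/
def valenceEq {M : Type u} [TopologicalSpace M] (x : M) (n : Cardinal.{u}) : Prop :=
  ∀ C : ℕ → Set (({x}ᶜ : Set M)), IsExhaustion C → Cardinal.mk (EndsSpace C) = n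

/-- The valence of `x` is at least `n`: `M ∖ {x}` has at least `n` ends (with respect to any
exhaustion). -/
def valenceGe {M : Type u} [TopologicalSpace M] (x : M) (n : Cardinal.{u}) : Prop :=
  ∀ C : ℕ → Set (({x}ᶜ : Set M)), IsExhaustion C → n ≤ Cardinal.mk (EndsSpace C)

/-- `x` is a local cut point: `M ∖ {x}` is disconnected, or it is connected and has more
than one end. -/
def IsLocalCutPoint (M : Type u) [TopologicalSpace M] (x : M) : Prop :=
  ¬ IsPreconnected ({x}ᶜ : Set M) ∨
    (IsPreconnected ({x}ᶜ : Set M) ∧ valenceGe x 2)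

/-- `{a, b}` is a cut pair: `a ≠ b`, neither is a global cut point, and `M ∖ {a, b}` is
disconnected. -/
def IsCutPair (M : Type*) [TopologicalSpace M] (a b : M) : Prop :=
  a ≠ b ∧ ¬ IsGlobalCutPoint M a ∧ ¬ IsGlobalCutPoint M b ∧
    ¬ IsPreconnected ({a, b}ᶜ : Set M)

/-- The pair `{c, d}` separates the points `x` and `y`: both lie in `M ∖ {c, d}`, in
distinct connected components. -/
def PairSeparatesPoints (M : Type*) [TopologicalSpace M] (c d x y : M) : Prop :=
  x ∈ ({c, d}ᶜ : Set M) ∧ y ∈ ({c, d}ᶜ : Set M) ∧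
    connectedComponentIn ({c, d}ᶜ : Set M) x ≠ connectedComponentIn ({c, d}ᶜ : Set M) y

/-- The relation on `M` identifying `g • a` with `g • b` for every `g ∈ G`. -/
def pairIdentRel (G : Type*) {M : Type*} [Group G] [MulAction G M] (a b : M) :
    M → M → Prop :=
  fun x y => x = y ∨ ∃ g : G, (x = g • a ∧ y = g • b) ∨ (x = g • b ∧ y = g • a)

/-- A set closed under a relation in both directions is saturated for the quotient map. -/
theorem Quot.preimage_image_mk_eq {M : Type*} {r : M → M → Prop} {S : Set M}
    (hS : ∀ x y, r x y → (x ∈ S ↔ y ∈ S)) :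
    Quot.mk r ⁻¹' (Quot.mk r '' S) = S := by
  refine Subset.antisymm ?_ (subset_preimage_image _ _)
  rintro y ⟨x, hx, hxy⟩
  have h := congrArg (Quot.lift (· ∈ S) fun x y h => propext (hS x y h)) hxy
  exact h.mp hx

/-- The image of a saturated open set under the quotient map is open. -/
theorem Quot.isOpen_image_mk {M : Type*} [TopologicalSpace M] {r : M → M → Prop} {S : Set M}
    (hS : ∀ x y, r x y → (x ∈ S ↔ y ∈ S)) (ho : IsOpen S) :
    IsOpen (Quot.mk r '' S) := by
  rw [← isQuotientMap_quot_mk.isOpen_preimage, Quot.preimage_image_mk_eq hS]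
  exact ho

/-- A set that is not preconnected has two points with distinct connected components. -/
theorem exists_connectedComponentIn_ne {M : Type*} [TopologicalSpace M] {S : Set M}
    (hS : ¬ IsPreconnected S) :
    ∃ x ∈ S, ∃ y ∈ S, connectedComponentIn S x ≠ connectedComponentIn S y := by
  by_contra! h
  refine hS (isPreconnected_of_forall_pair fun x hx y hy =>
    ⟨connectedComponentIn S x, connectedComponentIn_subset S x, mem_connectedComponentIn hx, ?_,
      isPreconnected_connectedComponentIn⟩)
  rw [h x hx y hy]
  exact mem_connectedComponentIn hy

/-- The translate of a disconnecting pair is disconnecting. -/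
theorem not_isPreconnected_compl_smul_pair {G M : Type*} [Group G] [TopologicalSpace M]
    [MulAction G M] (hcont : ContinuousActionOn G M) {a b : M}
    (h : ¬ IsPreconnected ({a, b}ᶜ : Set M)) (g : G) :
    ¬ IsPreconnected ({g • a, g • b}ᶜ : Set M) := by
  intro hp
  apply h
  have hi := hp.image (fun x => g⁻¹ • x) (hcont g⁻¹).continuousOn
  have he : (fun x : M => g⁻¹ • x) '' ({g • a, g • b}ᶜ : Set M) = {a, b}ᶜ := by
    rw [image_smul, smul_set_compl, smul_set_insert, smul_set_singleton, inv_smul_smul,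
      inv_smul_smul]
  rwa [he] at hi

/-- If the translates of `{a, b}` are pairwise inseparable and pairwise equal or disjoint, then
each component of the complement of a translate is saturated. -/
theorem pairIdentRel.mem_connectedComponentIn_iff {G M : Type*} [Group G] [TopologicalSpace M]
    [MulAction G M] {a b : M}
    (hinsep : ∀ g h : G, ¬ PairSeparatesPoints M (h • a) (h • b) (g • a) (g • b))
    (hdisj : ∀ g h : G, ({g • a, g • b} : Set M) ≠ ({h • a, h • b} : Set M) →
      ({g • a, g • b} : Set M) ∩ ({h • a, h • b} : Set M) = ∅)
    (g : G) (z x y : M) (hxy : pairIdentRel G a b x y) :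
    x ∈ connectedComponentIn ({g • a, g • b}ᶜ : Set M) z ↔
      y ∈ connectedComponentIn ({g • a, g • b}ᶜ : Set M) z := by
  have key : ∀ h : G, h • a ∈ connectedComponentIn ({g • a, g • b}ᶜ : Set M) z ↔
      h • b ∈ connectedComponentIn ({g • a, g • b}ᶜ : Set M) z := by
    intro h
    have hmem : h • a ∈ ({g • a, g • b} : Set M) ↔ h • b ∈ ({g • a, g • b} : Set M) := by
      by_cases he : ({h • a, h • b} : Set M) = {g • a, g • b}
      · rw [← he]; simp
      · have hd := disjoint_iff_inter_eq_empty.mpr (hdisj h g he)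
        exact iff_of_false (disjoint_left.mp hd (by simp)) (disjoint_left.mp hd (by simp))
    have hsame : h • a ∈ ({g • a, g • b}ᶜ : Set M) → h • b ∈ ({g • a, g • b}ᶜ : Set M) →
        connectedComponentIn ({g • a, g • b}ᶜ : Set M) (h • a) =
          connectedComponentIn ({g • a, g • b}ᶜ : Set M) (h • b) := fun ha hb => by
      by_contra hne
      exact hinsep h g ⟨ha, hb, hne⟩
    constructor
    · intro hz
      have ha := connectedComponentIn_subset _ _ hz
      have hb : h • b ∈ ({g • a, g • b}ᶜ : Set M) := fun hb => ha (hmem.mpr hb)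
      rw [connectedComponentIn_eq hz, hsame ha hb]
      exact mem_connectedComponentIn hb
    · intro hz
      have hb := connectedComponentIn_subset _ _ hz
      have ha : h • a ∈ ({g • a, g • b}ᶜ : Set M) := fun ha => hb (hmem.mp ha)
      rw [connectedComponentIn_eq hz, ← hsame ha hb]
      exact mem_connectedComponentIn ha
  rcases hxy with rfl | ⟨h, ⟨rfl, rfl⟩ | ⟨rfl, rfl⟩⟩
  · rfl
  · exact key h
  · exact (key h).symm

/-- Let `M` be a Peano continuum, `G` a group acting on `M` by
homeomorphisms, and `{a,b}` a cut pair all of whose `G`-translates are translate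
inseparable and whose distinct translates are pairwise disjoint.  Let `Q` be the quotient
of `M` identifying `g • a` with `g • b` for every `g ∈ G`, with quotient map `q`.  Then
each point `q (g • a) = q (g • b)` is a global cut point of `Q`; moreover distinct
components of `M ∖ {g•a, g•b}` have disjoint images under `q`, each of which is a union of
components of `Q ∖ {q (g•a)}`. -/
theorem quotient_of_translate_inseparable_cut_pair_has_cut_points
    {G M : Type*} [Group G] [MetricSpace M] [CompactSpace M] [ConnectedSpace M]
    [LocallyConnectedSpace M] [MulAction G M]
    (hcont : ContinuousActionOn G M)
    (a b : M) (hcp : IsCutPair M a b)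
    (hinsep : ∀ g h : G, ¬ PairSeparatesPoints M (h • a) (h • b) (g • a) (g • b))
    (hdisj : ∀ g h : G, ({g • a, g • b} : Set M) ≠ ({h • a, h • b} : Set M) →
      ({g • a, g • b} : Set M) ∩ ({h • a, h • b} : Set M) = ∅) :
    (∀ g : G,
        IsGlobalCutPoint (Quot (pairIdentRel G a b)) (Quot.mk (pairIdentRel G a b) (g • a))) ∧
      (∀ g : G, ∀ x y : M, x ∈ ({g • a, g • b}ᶜ : Set M) → y ∈ ({g • a, g • b}ᶜ : Set M) →
        connectedComponentIn ({g • a, g • b}ᶜ : Set M) x ≠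
            connectedComponentIn ({g • a, g • b}ᶜ : Set M) y →
          Quot.mk (pairIdentRel G a b) '' connectedComponentIn ({g • a, g • b}ᶜ : Set M) x ∩
              Quot.mk (pairIdentRel G a b) '' connectedComponentIn ({g • a, g • b}ᶜ : Set M) y
            = ∅) ∧
      ∀ g : G, ∀ x ∈ ({g • a, g • b}ᶜ : Set M),
        ∀ w ∈ Quot.mk (pairIdentRel G a b) '' connectedComponentIn ({g • a, g • b}ᶜ : Set M) x,
          connectedComponentIn ({Quot.mk (pairIdentRel G a b) (g • a)}ᶜ :
              Set (Quot (pairIdentRel G a b))) w ⊆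
            Quot.mk (pairIdentRel G a b) '' connectedComponentIn ({g • a, g • b}ᶜ : Set M) x := by
  have hsat := pairIdentRel.mem_connectedComponentIn_iff hinsep hdisj
  have hpre : ∀ (g : G) (x : M), Quot.mk (pairIdentRel G a b) ⁻¹'
      (Quot.mk (pairIdentRel G a b) '' connectedComponentIn ({g • a, g • b}ᶜ : Set M) x) =
        connectedComponentIn ({g • a, g • b}ᶜ : Set M) x :=
    fun g x => Quot.preimage_image_mk_eq (hsat g x)
  have hab : ∀ g : G, Quot.mk (pairIdentRel G a b) (g • b) =
      Quot.mk (pairIdentRel G a b) (g • a) :=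
    fun g => Quot.sound (Or.inr ⟨g, Or.inr ⟨rfl, rfl⟩⟩)
  have hopen : ∀ (g : G) (x : M), IsOpen
      (Quot.mk (pairIdentRel G a b) '' connectedComponentIn ({g • a, g • b}ᶜ : Set M) x) :=
    fun g x => Quot.isOpen_image_mk (hsat g x)
      (((Set.toFinite {g • a, g • b}).isClosed.isOpen_compl).connectedComponentIn)
  have hdis : ∀ (g : G) (x y : M),
      connectedComponentIn ({g • a, g • b}ᶜ : Set M) x ≠
        connectedComponentIn ({g • a, g • b}ᶜ : Set M) y →
      Quot.mk (pairIdentRel G a b) '' connectedComponentIn ({g • a, g • b}ᶜ : Set M) x ∩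
        Quot.mk (pairIdentRel G a b) '' connectedComponentIn ({g • a, g • b}ᶜ : Set M) y = ∅ := by
    intro g x y hne
    rw [eq_empty_iff_forall_notMem]
    rintro _ ⟨⟨u, hu, rfl⟩, hv⟩
    have hu' : u ∈ connectedComponentIn ({g • a, g • b}ᶜ : Set M) y := by
      rw [← hpre g y]; exact hv
    exact hne ((connectedComponentIn_eq hu).trans (connectedComponentIn_eq hu').symm)
  have hsub : ∀ (g : G) (x : M) (T : Set (Quot (pairIdentRel G a b))), IsPreconnected T →
      T ⊆ {Quot.mk (pairIdentRel G a b) (g • a)}ᶜ →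
      (T ∩ Quot.mk (pairIdentRel G a b) ''
        connectedComponentIn ({g • a, g • b}ᶜ : Set M) x).Nonempty →
      T ⊆ Quot.mk (pairIdentRel G a b) '' connectedComponentIn ({g • a, g • b}ᶜ : Set M) x := by
    intro g x T hT hTsub hne
    have hV : IsOpen (⋃ y ∈ {y : M | connectedComponentIn ({g • a, g • b}ᶜ : Set M) x ≠
        connectedComponentIn ({g • a, g • b}ᶜ : Set M) y},
        Quot.mk (pairIdentRel G a b) '' connectedComponentIn ({g • a, g • b}ᶜ : Set M) y) :=
      isOpen_biUnion fun y _ => hopen g y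
    refine hT.subset_left_of_subset_union (hopen g x) hV ?_ ?_ hne
    · simp only [disjoint_iUnion_right]
      exact fun y hy => disjoint_iff_inter_eq_empty.mpr (hdis g x y hy)
    · intro w hw
      obtain ⟨u, rfl⟩ := Quot.exists_rep w
      have hu : u ∈ ({g • a, g • b}ᶜ : Set M) := by
        rintro (rfl | rfl)
        · exact hTsub hw rfl
        · exact hTsub hw (hab g)
      by_cases he : connectedComponentIn ({g • a, g • b}ᶜ : Set M) x =
          connectedComponentIn ({g • a, g • b}ᶜ : Set M) u
      · exact Or.inl ⟨u, he ▸ mem_connectedComponentIn hu, rfl⟩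
      · exact Or.inr (mem_biUnion (x := u) he ⟨u, mem_connectedComponentIn hu, rfl⟩)
  have hmem : ∀ (g : G) (x u : M), u ∈ connectedComponentIn ({g • a, g • b}ᶜ : Set M) x →
      Quot.mk (pairIdentRel G a b) u ∈
        ({Quot.mk (pairIdentRel G a b) (g • a)}ᶜ : Set (Quot (pairIdentRel G a b))) := by
    intro g x u hu heq
    have hga : g • a ∈ connectedComponentIn ({g • a, g • b}ᶜ : Set M) x := by
      rw [← hpre g x]
      exact ⟨u, hu, heq⟩
    exact connectedComponentIn_subset _ _ hga (Or.inl rfl)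
  refine ⟨fun g hp => ?_, fun g x y _ _ hne => hdis g x y hne, ?_⟩
  · obtain ⟨x, hx, y, hy, hne⟩ := exists_connectedComponentIn_ne
      (not_isPreconnected_compl_smul_pair hcont hcp.2.2.2 g)
    have hxx := mem_connectedComponentIn hx
    have hyy := mem_connectedComponentIn hy
    have hyx := hsub g x _ hp Subset.rfl ⟨_, hmem g x x hxx, mem_image_of_mem _ hxx⟩
      (hmem g y y hyy)
    exact (eq_empty_iff_forall_notMem.mp (hdis g x y hne)) _ ⟨hyx, mem_image_of_mem _ hyy⟩
  · rintro g x - w ⟨u, hu, rfl⟩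
    exact hsub g x _ isPreconnected_connectedComponentIn (connectedComponentIn_subset _ _)
      ⟨_, mem_connectedComponentIn (hmem g x u hu), mem_image_of_mem _ hu⟩
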